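/- Let p : [0,1] → [1,∞] be Lebesgue measurable. Then AAAS^{p(x)}([0,∞):X) ⊆ AAAS^1([0,∞):X), and the embedding is continuous: there exists a constant c > 0, independent of f, such that ‖f‖_{S^1} ≤ c ‖f‖_{S^{p(x)}} for every f ∈ AAAS^{p(x)}([0,∞):X). (Here AAAS^1 denotes the asymptotically Stepanov almost automorphic class for the constant exponent p(x) ≡ 1.) -/

import Mathlib

open MeasureTheory Filter Topology Set
open scoped ENNReal

noncomputable section

/-- φ_{p(x)}(t): t^{p(x)} if p(x) < ∞; if p(x) = ∞ then 0 for t ≤ 1 and ∞ for t > 1. -/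
def phiVar (p : ℝ → ℝ≥0∞) (x : ℝ) (t : ℝ) : ℝ≥0∞ :=
  if p x ≠ ∞ then ENNReal.ofReal (t ^ (p x).toReal)
  else if t ≤ 1 then 0 else ∞

/-- ρ(u) := ∫_{[0,1]} φ_{p(x)}(u(x)) dx, for a scalar (norm-valued) function u. -/
def rhoVar (p : ℝ → ℝ≥0∞) (u : ℝ → ℝ) : ℝ≥0∞ :=
  ∫⁻ x in Set.Icc (0:ℝ) 1, phiVar p x (u x)

/-- Membership in L^{p(x)}([0,1]:E). -/
def MemLpVar {E : Type*} [NormedAddCommGroup E] (p : ℝ → ℝ≥0∞) (f : ℝ → E) : Prop :=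
  AEStronglyMeasurable f (volume.restrict (Set.Icc (0:ℝ) 1)) ∧
    ∃ c : ℝ, 0 < c ∧ rhoVar p (fun x => c * ‖f x‖) < ∞

/-- The Luxemburg norm of f in L^{p(x)}([0,1]:E). -/
def luxNorm {E : Type*} [NormedAddCommGroup E] (p : ℝ → ℝ≥0∞) (f : ℝ → E) : ℝ :=
  sInf {lam : ℝ | 0 < lam ∧ rhoVar p (fun x => ‖f x‖ / lam) ≤ 1}

/-- Stepanov p(x)-boundedness on the interval I. -/
def SBdd {E : Type*} [NormedAddCommGroup E] (p : ℝ → ℝ≥0∞) (I : Set ℝ) (f : ℝ → E) : Prop :=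
  (∀ t ∈ I, MemLpVar p (fun x => f (t + x))) ∧
    BddAbove ((fun t => luxNorm p (fun x => f (t + x))) '' I)

/-- The Stepanov norm ‖f‖_{S^{p(x)}} on the interval I. -/
def SNorm {E : Type*} [NormedAddCommGroup E] (p : ℝ → ℝ≥0∞) (I : Set ℝ) (f : ℝ → E) : ℝ :=
  sSup ((fun t => luxNorm p (fun x => f (t + x))) '' I)

/-- Stepanov p(x)-almost automorphy (AAS^{p(x)}(ℝ:E)). -/
def AASVar {E : Type*} [NormedAddCommGroup E] (p : ℝ → ℝ≥0∞) (f : ℝ → E) : Prop :=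
  SBdd p Set.univ f ∧
    ∀ a : ℕ → ℝ, ∃ n : ℕ → ℕ, StrictMono n ∧ ∃ g : ℝ → E, SBdd p Set.univ g ∧
      ∀ t : ℝ,
        Tendsto (fun k => luxNorm p (fun x => f (a (n k) + t + x) - g (t + x))) atTop (𝓝 0) ∧
        Tendsto (fun k => luxNorm p (fun x => g (t - a (n k) + x) - f (t + x))) atTop (𝓝 0)

/-- The class S_0^{p(x)}([0,∞):E) of Stepanov vanishing functions. -/
def S0Var {E : Type*} [NormedAddCommGroup E] (p : ℝ → ℝ≥0∞) (f : ℝ → E) : Prop :=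
  SBdd p (Set.Ici 0) f ∧ Tendsto (fun t => luxNorm p (fun x => f (t + x))) atTop (𝓝 0)

/-- Asymptotic Stepanov p(x)-almost automorphy (AAAS^{p(x)}([0,∞):E)). -/
def AAASVar {E : Type*} [NormedAddCommGroup E] (p : ℝ → ℝ≥0∞) (f : ℝ → E) : Prop :=
  SBdd p (Set.Ici 0) f ∧
    ∃ g q : ℝ → E, AASVar p g ∧ SBdd p (Set.Ici 0) q ∧
      (∀ t : ℝ, 0 ≤ t → f t = g t + q t) ∧
      Tendsto (fun t => luxNorm p (fun x => q (t + x))) atTop (𝓝 0)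

/-- Stepanov p(x)-almost periodicity on I: the map t ↦ f(t+·) is Bohr almost periodic
from I to L^{p(x)}([0,1]:E), i.e. continuous plus the relative density of ε-periods. -/
def APSVar {E : Type*} [NormedAddCommGroup E] (p : ℝ → ℝ≥0∞) (I : Set ℝ) (f : ℝ → E) : Prop :=
  SBdd p I f ∧
    (∀ t ∈ I, Tendsto (fun s => luxNorm p (fun x => f (s + x) - f (t + x))) (𝓝[I] t) (𝓝 0)) ∧
    ∀ ε : ℝ, 0 < ε → ∃ l : ℝ, 0 < l ∧ ∀ a : ℝ, Set.Icc a (a + l) ⊆ I →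
      ∃ τ ∈ Set.Icc a (a + l), ∀ t ∈ I, luxNorm p (fun x => f (t + τ + x) - f (t + x)) ≤ ε

/-- Almost automorphic function ℝ → E. -/
def AlmostAutomorphic {E : Type*} [NormedAddCommGroup E] (f : ℝ → E) : Prop :=
  Continuous f ∧
    ∀ b : ℕ → ℝ, ∃ n : ℕ → ℕ, StrictMono n ∧ ∃ g : ℝ → E,
      (∀ t : ℝ, Tendsto (fun k => f (t + b (n k))) atTop (𝓝 (g t))) ∧
      (∀ t : ℝ, Tendsto (fun k => g (t - b (n k))) atTop (𝓝 (f t)))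

/-- Compactly almost automorphic function ℝ → E. -/
def CompactAA {E : Type*} [NormedAddCommGroup E] (f : ℝ → E) : Prop :=
  Continuous f ∧
    ∀ b : ℕ → ℝ, ∃ n : ℕ → ℕ, StrictMono n ∧ ∃ g : ℝ → E,
      (∀ K : Set ℝ, IsCompact K →
        TendstoUniformlyOn (fun k t => f (t + b (n k))) g atTop K) ∧
      (∀ K : Set ℝ, IsCompact K →
        TendstoUniformlyOn (fun k t => g (t - b (n k))) f atTop K)

/-- Two-parameter Stepanov p(x)-almost automorphy (AAS^{p(x)}(ℝ×F:E)). -/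
def AAS2Var {E F : Type*} [NormedAddCommGroup E] [NormedAddCommGroup F]
    (p : ℝ → ℝ≥0∞) (f : ℝ → F → E) : Prop :=
  (∀ y : F, SBdd p Set.univ (fun t => f t y)) ∧
    ∀ a : ℕ → ℝ, ∃ n : ℕ → ℕ, StrictMono n ∧ ∃ g : ℝ → F → E,
      (∀ y : F, SBdd p Set.univ (fun t => g t y)) ∧
      ∀ (t : ℝ) (y : F),
        Tendsto (fun k => luxNorm p (fun x => f (t + a (n k) + x) y - g (t + x) y)) atTop (𝓝 0) ∧
        Tendsto (fun k => luxNorm p (fun x => g (t - a (n k) + x) y - f (t + x) y)) atTop (𝓝 0)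


theorem aux_phi_one (x t : ℝ) : phiVar (fun _ => (1 : ℝ≥0∞)) x t = ENNReal.ofReal t := by
  simp [phiVar]

theorem aux_phi_le (p : ℝ → ℝ≥0∞) (x t : ℝ) (hp : 1 ≤ p x) (ht : 0 ≤ t) :
    ENNReal.ofReal t ≤ 1 + phiVar p x t := by
  unfold phiVar
  by_cases h1 : t ≤ 1
  · calc ENNReal.ofReal t ≤ 1 := by simpa using h1
      _ ≤ _ := le_self_add
  · refine le_trans ?_ le_add_self
    split_ifs with h
    · have h2 : 1 ≤ (p x).toReal := by
        simpa using ENNReal.toReal_mono h hp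
      exact ENNReal.ofReal_le_ofReal (Real.self_le_rpow_of_one_le (not_le.1 h1).le h2)
    · exact le_top

theorem aux_phi_mono (p : ℝ → ℝ≥0∞) (x s t : ℝ) (hs : 0 ≤ s) (hst : s ≤ t) :
    phiVar p x s ≤ phiVar p x t := by
  unfold phiVar
  by_cases h : p x ≠ ∞
  · rw [if_pos h, if_pos h]
    exact ENNReal.ofReal_le_ofReal (Real.rpow_le_rpow hs hst ENNReal.toReal_nonneg)
  · rw [if_neg h, if_neg h]
    split_ifs with h1 h2 h2
    · exact le_rfl
    · exact zero_le
    · exact absurd (hst.trans h2) h1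
    · exact le_rfl

theorem aux_phi_scale (p : ℝ → ℝ≥0∞) (x s t : ℝ) (hp : 1 ≤ p x) (hs : 0 < s) (hs1 : s ≤ 1)
    (ht : 0 ≤ t) : phiVar p x (s * t) ≤ ENNReal.ofReal s * phiVar p x t := by
  unfold phiVar
  by_cases h : p x ≠ ∞
  · rw [if_pos h, if_pos h, ← ENNReal.ofReal_mul hs.le, Real.mul_rpow hs.le ht]
    have h2 : 1 ≤ (p x).toReal := by
      simpa using ENNReal.toReal_mono h hp
    refine ENNReal.ofReal_le_ofReal (mul_le_mul_of_nonneg_right ?_ (Real.rpow_nonneg ht _))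
    exact Real.rpow_le_self_of_le_one hs.le hs1 h2
  · rw [if_neg h, if_neg h]
    by_cases h1 : s * t ≤ 1
    · rw [if_pos h1]; exact zero_le
    · have h2 : ¬ t ≤ 1 := fun h2 => h1 (by nlinarith)
      rw [if_neg h1, if_neg h2, ENNReal.mul_top]
      simpa using hs

theorem aux_rho_one_le (p : ℝ → ℝ≥0∞) (hp1 : ∀ x ∈ Set.Icc (0:ℝ) 1, 1 ≤ p x) (u : ℝ → ℝ)
    (hu : ∀ x, 0 ≤ u x) : rhoVar (fun _ => (1 : ℝ≥0∞)) u ≤ 1 + rhoVar p u := by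
  unfold rhoVar
  calc _ ≤ ∫⁻ x in Set.Icc (0:ℝ) 1, (1 + phiVar p x (u x)) := by
        refine setLIntegral_mono' measurableSet_Icc fun x hx => ?_
        rw [aux_phi_one]
        exact aux_phi_le p x _ (hp1 x hx) (hu x)
    _ = _ := by
        rw [lintegral_add_left measurable_const]
        simp

theorem aux_rho_scale (p : ℝ → ℝ≥0∞) (hp1 : ∀ x ∈ Set.Icc (0:ℝ) 1, 1 ≤ p x) (u : ℝ → ℝ)
    (hu : ∀ x, 0 ≤ u x) (s : ℝ) (hs : 0 < s) (hs1 : s ≤ 1) :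
    rhoVar p (fun x => s * u x) ≤ ENNReal.ofReal s * rhoVar p u := by
  unfold rhoVar
  rw [← lintegral_const_mul' _ _ ENNReal.ofReal_ne_top]
  exact setLIntegral_mono' measurableSet_Icc fun x hx =>
    aux_phi_scale p x s _ (hp1 x hx) hs hs1 (hu x)

section
variable {X : Type*} [NormedAddCommGroup X]

theorem aux_nonempty (p : ℝ → ℝ≥0∞) (hp1 : ∀ x ∈ Set.Icc (0:ℝ) 1, 1 ≤ p x) (f : ℝ → X)
    (hf : MemLpVar p f) :
    {lam : ℝ | 0 < lam ∧ rhoVar p (fun x => ‖f x‖ / lam) ≤ 1}.Nonempty := by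
  obtain ⟨-, c, hc, hr⟩ := hf
  set R := (rhoVar p (fun x => c * ‖f x‖)).toReal with hR
  have hR0 : 0 ≤ R := ENNReal.toReal_nonneg
  have hs : 0 < 1 / (1 + R) := by positivity
  refine ⟨(1 + R) / c, by positivity, ?_⟩
  have h := aux_rho_scale p hp1 (fun x => c * ‖f x‖) (fun x => by positivity) (1 / (1 + R)) hs
    (by rw [div_le_one (by positivity)]; linarith)
  have e : (fun x => ‖f x‖ / ((1 + R) / c)) = fun x => 1 / (1 + R) * (c * ‖f x‖) := by
    funext x
    have : (1 + R) ≠ 0 := by positivity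
    field_simp
  rw [e]
  refine h.trans ?_
  rw [← ENNReal.ofReal_toReal hr.ne, ← ENNReal.ofReal_mul hs.le]
  rw [← hR, ENNReal.ofReal_le_one, one_div_mul_eq_div, div_le_one (by positivity)]
  linarith

theorem aux_lux_nonneg (p : ℝ → ℝ≥0∞) (f : ℝ → X) : 0 ≤ luxNorm p f :=
  Real.sInf_nonneg fun _ h => h.1.le

theorem aux_lux_le (p : ℝ → ℝ≥0∞) (hp1 : ∀ x ∈ Set.Icc (0:ℝ) 1, 1 ≤ p x) (f : ℝ → X)
    (hf : MemLpVar p f) : luxNorm (fun _ => (1 : ℝ≥0∞)) f ≤ 2 * luxNorm p f := by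
  have key : luxNorm (fun _ => (1 : ℝ≥0∞)) f / 2 ≤ luxNorm p f := by
    refine le_csInf (aux_nonempty p hp1 f hf) ?_
    rintro lam ⟨hl, hr⟩
    rw [div_le_iff₀ (by norm_num)]
    refine csInf_le ⟨0, fun _ h => h.1.le⟩ ⟨by positivity, ?_⟩
    have e : (fun x => ‖f x‖ / (lam * 2)) = fun x => (1 / 2) * (‖f x‖ / lam) := by
      funext x
      field_simp
    rw [e]
    refine (aux_rho_scale _ (fun _ _ => le_rfl) (fun x => ‖f x‖ / lam)
      (fun x => by positivity) (1 / 2) (by norm_num) (by norm_num)).trans ?_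
    have h2 : rhoVar (fun _ => (1 : ℝ≥0∞)) (fun x => ‖f x‖ / lam) ≤ ENNReal.ofReal 2 := by
      refine (aux_rho_one_le p hp1 _ (fun x => by positivity)).trans ?_
      refine (add_le_add_right hr 1).trans ?_
      norm_num
    refine (mul_le_mul_right h2 _).trans ?_
    rw [← ENNReal.ofReal_mul (by norm_num)]
    norm_num
  linarith

theorem aux_mem (p : ℝ → ℝ≥0∞) (hp1 : ∀ x ∈ Set.Icc (0:ℝ) 1, 1 ≤ p x) (f : ℝ → X)
    (hf : MemLpVar p f) : MemLpVar (fun _ => (1 : ℝ≥0∞)) f := by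
  obtain ⟨h, c, hc, hr⟩ := hf
  refine ⟨h, c, hc, (aux_rho_one_le p hp1 _ (fun x => by positivity)).trans_lt ?_⟩
  exact ENNReal.add_lt_top.2 ⟨ENNReal.one_lt_top, hr⟩

theorem aux_phi_max (p : ℝ → ℝ≥0∞) (x a b : ℝ) :
    phiVar p x (max a b) ≤ max (phiVar p x a) (phiVar p x b) := by
  rcases le_total a b with h | h
  · rw [max_eq_right h]; exact le_max_right _ _
  · rw [max_eq_left h]; exact le_max_left _ _

theorem aux_pow_meas (p : ℝ → ℝ≥0∞) (hpm : Measurable p) (u : ℝ → ℝ) 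
    (hu : AEMeasurable u (volume.restrict (Set.Icc (0:ℝ) 1))) :
    AEMeasurable (fun x => phiVar p x (u x)) (volume.restrict (Set.Icc (0:ℝ) 1)) := by
  have hphi : Measurable (fun z : ℝ × ℝ => phiVar p z.1 z.2) := by
    unfold phiVar
    refine Measurable.ite ?_ ?_ ?_
    · exact ((hpm.comp measurable_fst) (measurableSet_singleton ∞)).compl
    · exact (measurable_snd.pow (hpm.comp measurable_fst).ennreal_toReal).ennreal_ofReal
    · exact Measurable.ite (measurableSet_le measurable_snd measurable_const)
        measurable_const measurable_const
  exact hphi.comp_aemeasurable (aemeasurable_id.prodMk hu)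

theorem aux_sub (p : ℝ → ℝ≥0∞) (hpm : Measurable p) (f g : ℝ → X)
    (hf : MemLpVar p f) (hg : MemLpVar p g) : MemLpVar p (fun x => f x - g x) := by
  obtain ⟨h, c, hc, hr⟩ := hf
  obtain ⟨h', c', hc', hr'⟩ := hg
  have hm : 0 < min c c' := lt_min hc hc'
  refine ⟨h.sub h', min c c' / 2, by positivity, ?_⟩
  refine lt_of_le_of_lt ?_ (ENNReal.add_lt_top.2 ⟨hr, hr'⟩)
  unfold rhoVar
  rw [← lintegral_add_left' (aux_pow_meas p hpm _ (h.norm.aemeasurable.const_mul c))]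
  refine lintegral_mono fun x => ?_
  have e : min c c' / 2 * ‖f x - g x‖ ≤ max (c * ‖f x‖) (c' * ‖g x‖) := by
    have h1 := norm_sub_le (f x) (g x)
    have h2 : min c c' * ‖f x‖ ≤ c * ‖f x‖ :=
      mul_le_mul_of_nonneg_right (min_le_left _ _) (norm_nonneg _)
    have h3 : min c c' * ‖g x‖ ≤ c' * ‖g x‖ :=
      mul_le_mul_of_nonneg_right (min_le_right _ _) (norm_nonneg _)
    have h4 := mul_le_mul_of_nonneg_left h1 hm.le
    have h5 := le_max_left (c * ‖f x‖) (c' * ‖g x‖)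
    have h6 := le_max_right (c * ‖f x‖) (c' * ‖g x‖)
    linarith
  refine (aux_phi_mono p x _ _ (by positivity) e).trans ((aux_phi_max _ _ _ _).trans ?_)
  exact max_le le_self_add le_add_self

theorem aux_tendsto (p : ℝ → ℝ≥0∞) (hp1 : ∀ x ∈ Set.Icc (0:ℝ) 1, 1 ≤ p x) {ι : Type*}
    (l : Filter ι) (F : ι → ℝ → X) (hF : ∀ᶠ k in l, MemLpVar p (F k))
    (h : Tendsto (fun k => luxNorm p (F k)) l (𝓝 0)) :
    Tendsto (fun k => luxNorm (fun _ => (1 : ℝ≥0∞)) (F k)) l (𝓝 0) := by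
  refine squeeze_zero' (Eventually.of_forall fun k => aux_lux_nonneg _ _)
    (hF.mono fun k hk => aux_lux_le p hp1 _ hk) ?_
  simpa using h.const_mul 2

theorem aux_sbdd (p : ℝ → ℝ≥0∞) (hp1 : ∀ x ∈ Set.Icc (0:ℝ) 1, 1 ≤ p x) (I : Set ℝ) (f : ℝ → X)
    (hf : SBdd p I f) : SBdd (fun _ => (1 : ℝ≥0∞)) I f := by
  obtain ⟨h, M, hM⟩ := hf
  refine ⟨fun t ht => aux_mem p hp1 _ (h t ht), 2 * M, ?_⟩
  rintro _ ⟨t, ht, rfl⟩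
  have h1 := aux_lux_le p hp1 _ (h t ht)
  have h2 := hM (Set.mem_image_of_mem _ ht)
  simp only at h2 ⊢
  linarith

end

/-- AAAS^{p(x)}([0,∞):X) ⊆ AAAS^1([0,∞):X) with a continuous embedding. -/
theorem aaas_px_embeds_aaas_one
    {X : Type*} [NormedAddCommGroup X] [NormedSpace ℂ X] [CompleteSpace X]
    (p : ℝ → ℝ≥0∞) (hpmeas : Measurable p) (hp1 : ∀ x ∈ Set.Icc (0:ℝ) 1, 1 ≤ p x) :
    (∀ f : ℝ → X, AAASVar p f → AAASVar (fun _ => (1 : ℝ≥0∞)) f) ∧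
    ∃ c : ℝ, 0 < c ∧ ∀ f : ℝ → X, AAASVar p f →
      SNorm (fun _ => (1 : ℝ≥0∞)) (Set.Ici 0) f ≤ c * SNorm p (Set.Ici 0) f := by
  refine ⟨?_, 2, by norm_num, ?_⟩
  · rintro f ⟨hf, g, q, ⟨hg, hga⟩, hq, hfgq, hq0⟩
    refine ⟨aux_sbdd p hp1 _ f hf, g, q, ⟨aux_sbdd p hp1 _ g hg, fun a => ?_⟩,
      aux_sbdd p hp1 _ q hq, hfgq, ?_⟩
    · obtain ⟨n, hn, G, hG, hlim⟩ := hga a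
      refine ⟨n, hn, G, aux_sbdd p hp1 _ G hG, fun t => ⟨?_, ?_⟩⟩
      · exact aux_tendsto p hp1 atTop (fun k x => g (a (n k) + t + x) - G (t + x))
          (Eventually.of_forall fun k => aux_sub p hpmeas _ _ (hg.1 _ (Set.mem_univ _))
            (hG.1 _ (Set.mem_univ _))) (hlim t).1
      · exact aux_tendsto p hp1 atTop (fun k x => G (t - a (n k) + x) - g (t + x))
          (Eventually.of_forall fun k => aux_sub p hpmeas _ _ (hG.1 _ (Set.mem_univ _))
            (hg.1 _ (Set.mem_univ _))) (hlim t).2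
    · exact aux_tendsto p hp1 atTop (fun t x => q (t + x))
        ((eventually_ge_atTop 0).mono fun t ht => hq.1 t ht) hq0
  · rintro f ⟨hf, -⟩
    refine csSup_le (Set.Nonempty.image _ Set.nonempty_Ici) ?_
    rintro _ ⟨t, ht, rfl⟩
    refine (aux_lux_le p hp1 _ (hf.1 t ht)).trans ?_
    refine mul_le_mul_of_nonneg_left ?_ (by norm_num)
    exact le_csSup hf.2 (Set.mem_image_of_mem _ ht)

end
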